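/- The number of multi-chains 1 ≤ a₁ ≤ a₂ ≤ ⋯ ≤ a_{r-1} ≤ ⊤ in the lattice of noncrossing partitions of {1,…,d} (ordered by refinement, with ⊤ the partition with a single block) equals binomial(d·r, d-1)/d. -/

import Mathlib

/-- A partition (as a setoid) of `{0, …, d-1}` is noncrossing if there is no quadruple
`i₁ < j₁ < i₂ < j₂` with `i₁, i₂` in one block and `j₁, j₂` in a different block. -/
def IsNoncrossing {d : ℕ} (s : Setoid (Fin d)) : Prop :=
  ¬ ∃ i₁ j₁ i₂ j₂ : Fin d, i₁ < j₁ ∧ j₁ < i₂ ∧ i₂ < j₂ ∧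
      s.r i₁ i₂ ∧ s.r j₁ j₂ ∧ ¬ s.r i₁ j₁

/-- Multichains of `n` noncrossing partitions of `α`, the first `k` of which have the least
element of `α` (if there is one) as a singleton block. -/
abbrev NoncrossingChain (n k : ℕ) (α : Type*) [LinearOrder α] : Type _ :=
  {a : Fin n → Setoid α //
    (∀ j, ∀ x y z w, x < y → y < z → z < w → a j x z → a j y w → a j x y) ∧
    (∀ i j, i ≤ j → ∀ x y, a i x y → a j x y) ∧
    ∀ j : Fin n, (j : ℕ) < k → ∀ x, IsBot x → ∀ y, a j x y → x = y}

namespace NoncrossingChain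

open Finset

/-- The relation on `α` induced by a setoid on a subtype. -/
def extend {α : Type*} {p : α → Prop} (s : Setoid {x // p x}) (x y : α) : Prop :=
  ∃ (hx : p x) (hy : p y), s ⟨x, hx⟩ ⟨y, hy⟩

theorem extend_symm {α : Type*} {p : α → Prop} {s : Setoid {x // p x}} {x y : α} :
    extend s x y → extend s y x :=
  fun ⟨hx, hy, h⟩ => ⟨hy, hx, s.symm h⟩

theorem extend_trans {α : Type*} {p : α → Prop} {s : Setoid {x // p x}} {x y z : α} :
    extend s x y → extend s y z → extend s x z :=
  fun ⟨hx, _, h⟩ ⟨_, hz, h'⟩ => ⟨hx, hz, s.trans h h'⟩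

instance {α : Type*} [Finite α] : Finite (Setoid α) :=
  Finite.of_injective (fun s x y => s x y) fun _ _ h =>
    Setoid.ext fun x y => iff_of_eq (congrFun (congrFun h x) y)

variable {α β : Type*} [LinearOrder α] [LinearOrder β] {n k : ℕ}

/-- Restriction of a multichain along a strictly monotone map. -/
def comap (f : α → β) (hf : StrictMono f) (l : ℕ) (a : NoncrossingChain n k β)
    (h : ∀ j : Fin n, (j : ℕ) < l → ∀ x, IsBot x → ∀ y, a.1 j (f x) (f y) → x = y) :
    NoncrossingChain n l α :=
  ⟨fun j => (a.1 j).comap f,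
    fun j _ _ _ _ hxy hyz hzw => a.2.1 j _ _ _ _ (hf hxy) (hf hyz) (hf hzw),
    fun i j hij _ _ => a.2.2.1 i j hij _ _, h⟩

theorem card_congr (e : α ≃o β) :
    Nat.card (NoncrossingChain n k α) = Nat.card (NoncrossingChain n k β) := by
  refine Nat.card_congr
    { toFun := fun a => comap e.symm e.symm.strictMono k a fun j hj x hx y hxy =>
        e.symm.injective (a.2.2.2 j hj _ (fun z => ?_) _ hxy)
      invFun := fun a => comap e e.strictMono k a fun j hj x hx y hxy =>
        e.injective (a.2.2.2 j hj _ (fun z => ?_) _ hxy)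
      left_inv := fun a => Subtype.ext (funext fun j => Setoid.ext fun x y => ?_)
      right_inv := fun a => Subtype.ext (funext fun j => Setoid.ext fun x y => ?_) }
  · simpa [e.symm_apply_le] using hx (e z)
  · simpa [← e.le_symm_apply] using hx (e.symm z)
  · change a.1 j (e.symm (e x)) (e.symm (e y)) ↔ _
    simp
  · change a.1 j (e (e.symm x)) (e (e.symm y)) ↔ _
    simp

theorem extend_noncrossing {p : α → Prop} (a : NoncrossingChain n k {x // p x}) (j : Fin n)
    {x y z w : α} (hxy : x < y) (hyz : y < z) (hzw : z < w) :
    extend (a.1 j) x z → extend (a.1 j) y w → extend (a.1 j) x y :=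
  fun ⟨hx, _, h⟩ ⟨hy, _, h'⟩ =>
    ⟨hx, hy, a.2.1 j ⟨x, hx⟩ ⟨y, hy⟩ _ _ hxy hyz hzw h h'⟩

section Glue

variable [OrderBot α] {m : α} {k : Fin n}

/-- The multichains in which `m` is the largest element of the block of `⊥` in the `k`-th
partition, the earlier ones having `{⊥}` as a block. -/
abbrev Fiber (k : Fin n) (m : α) : Type _ :=
  {a : NoncrossingChain n k α // a.1 k ⊥ m ∧ ∀ y, a.1 k ⊥ y → y ≤ m}

theorem Fiber.rel_iff (a : Fiber k m) (j : Fin n) {x y : α} (hx : ⊥ < x ∧ x ≤ m)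
    (hy : ¬ (⊥ < y ∧ y ≤ m)) :
    a.1.1 j x y ↔ k ≤ j ∧ a.1.1 j x m ∧ a.1.1 j ⊥ y := by
  obtain ⟨⟨a, hnc, hmono, hbot⟩, hm, hmax⟩ := a
  change a k ⊥ m at hm
  change ∀ y, a k ⊥ y → y ≤ m at hmax
  change a j x y ↔ k ≤ j ∧ a j x m ∧ a j ⊥ y
  have hy' : y = ⊥ ∨ m < y := by
    rcases eq_or_ne y ⊥ with h | h
    · exact .inl h
    · exact .inr (not_le.1 fun h' => hy ⟨bot_lt_iff_ne_bot.2 h, h'⟩)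
  have key : ∀ i, k ≤ i → a i x y → a i x m ∧ a i ⊥ y := by
    intro i hi hxy
    have h0 := hmono k i hi _ _ hm
    rcases hy' with rfl | hy'
    · exact ⟨(a i).trans hxy h0, (a i).refl _⟩
    · rcases hx.2.eq_or_lt with rfl | hxm
      · exact ⟨(a i).refl _, (a i).trans h0 hxy⟩
      · have h1 := hnc i _ _ _ _ hx.1 hxm hy' h0 hxy
        exact ⟨(a i).trans ((a i).symm h1) h0, (a i).trans h1 hxy⟩
  constructor
  · intro hxy
    have hkj : k ≤ j := by
      by_contra hkj
      have hlt : j < k := not_le.1 hkj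
      have h1 := hmax _ (key k le_rfl (hmono j k hlt.le _ _ hxy)).2
      have h2 : y = ⊥ := hy'.resolve_right h1.not_gt
      subst h2
      exact hx.1.ne (hbot j hlt _ isBot_bot _ ((a j).symm hxy))
    exact ⟨hkj, key j hkj hxy⟩
  · rintro ⟨hkj, h1, h2⟩
    exact (a j).trans h1 ((a j).trans ((a j).symm (hmono k j hkj _ _ hm)) h2)

/-- Union of a partition of `Ioc ⊥ m` and one of its complement, the blocks of `m` and `⊥` being
merged if `q` holds. -/
def glueRel (q : Prop) (c : Setoid {x : α // ⊥ < x ∧ x ≤ m})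
    (e : Setoid {x : α // ¬ (⊥ < x ∧ x ≤ m)}) (x y : α) : Prop :=
  extend c x y ∨ extend e x y ∨
    q ∧ (extend c x m ∧ extend e ⊥ y ∨ extend e x ⊥ ∧ extend c m y)

/-- `glueRel` as a setoid. -/
def glueSetoid (q : Prop) (c : Setoid {x : α // ⊥ < x ∧ x ≤ m})
    (e : Setoid {x : α // ¬ (⊥ < x ∧ x ≤ m)}) : Setoid α where
  r := glueRel q c e
  iseqv := by
    have hc : ∀ {x y}, extend c x y → (⊥ < x ∧ x ≤ m) ∧ (⊥ < y ∧ y ≤ m) :=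
      fun ⟨h, h', _⟩ => ⟨h, h'⟩
    have he : ∀ {x y}, extend e x y → ¬ (⊥ < x ∧ x ≤ m) ∧ ¬ (⊥ < y ∧ y ≤ m) :=
      fun ⟨h, h', _⟩ => ⟨h, h'⟩
    have cs := @extend_symm _ _ c
    have es := @extend_symm _ _ e
    have ct := @extend_trans _ _ c
    have et := @extend_trans _ _ e
    refine ⟨fun x => ?_, fun {x y} h => ?_, fun {x y z} h h' => ?_⟩
    · by_cases hx : ⊥ < x ∧ x ≤ m
      · exact .inl ⟨hx, hx, c.refl _⟩
      · exact .inr (.inl ⟨hx, hx, e.refl _⟩)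
    · unfold glueRel at *; grind
    · unfold glueRel at *; grind

/-- `glueSetoid` applied along multichains. -/
def glue (c : NoncrossingChain n 0 {x : α // ⊥ < x ∧ x ≤ m})
    (e : NoncrossingChain n (k + 1) {x : α // ¬ (⊥ < x ∧ x ≤ m)}) :
    NoncrossingChain n k α := by
  refine ⟨fun j => glueSetoid (k ≤ j) (c.1 j) (e.1 j), ?_, ?_, ?_⟩
  · intro j x y z w hxy hyz hzw h h'
    change glueRel _ _ _ _ _ at h h' ⊢
    have hc : ∀ {x y}, extend (c.1 j) x y → (⊥ < x ∧ x ≤ m) ∧ (⊥ < y ∧ y ≤ m) :=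
      fun ⟨h, h', _⟩ => ⟨h, h'⟩
    have he : ∀ {x y}, extend (e.1 j) x y → (x = ⊥ ∨ m < x) ∧ (y = ⊥ ∨ m < y) := by
      rintro x y ⟨h, h', _⟩
      simpa [bot_lt_iff_ne_bot, imp_iff_not_or] using And.intro h h'
    have cs := @extend_symm _ _ (c.1 j)
    have es := @extend_symm _ _ (e.1 j)
    have ct := @extend_trans _ _ (c.1 j)
    have et := @extend_trans _ _ (e.1 j)
    have cn := @extend_noncrossing _ _ _ _ _ c j
    have en := @extend_noncrossing _ _ _ _ _ e j
    have hb : ∀ x : α, ⊥ ≤ x := fun _ => bot_le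
    have eb : extend (e.1 j) ⊥ ⊥ := ⟨by simp, by simp, (e.1 j).refl _⟩
    have hmy : extend (c.1 j) m z → extend (c.1 j) y w → extend (c.1 j) m y := by
      intro h1 h2
      rcases (hc h2).2.2.eq_or_lt with rfl | hw
      · exact cs h2
      · exact ct h1 (cs (cn hyz hzw hw h2 (cs h1)))
    unfold glueRel at *
    grind
  · intro i j hij x y h
    have hc : ∀ {x y}, extend (c.1 i) x y → extend (c.1 j) x y :=
      fun ⟨h, h', h''⟩ => ⟨h, h', c.2.2.1 i j hij _ _ h''⟩
    have he : ∀ {x y}, extend (e.1 i) x y → extend (e.1 j) x y :=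
      fun ⟨h, h', h''⟩ => ⟨h, h', e.2.2.1 i j hij _ _ h''⟩
    change glueRel _ _ _ _ _ at h ⊢
    exact h.imp hc (Or.imp he (And.imp (le_trans · hij)
      (Or.imp (And.imp hc he) (And.imp he hc))))
  · intro j hj x hx y h
    have hx : x = ⊥ := le_bot_iff.1 (hx ⊥)
    subst hx
    rcases h with ⟨h, _⟩ | ⟨_, h, h'⟩ | ⟨h, _⟩
    · exact absurd h.1 (lt_irrefl _)
    · exact congrArg Subtype.val (e.2.2.2 j (by omega) ⟨⊥, by simp⟩ (fun z => bot_le (a := z.1))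
        ⟨y, h⟩ h')
    · exact absurd h (not_le.2 hj)

theorem card_fiber (k : Fin n) (m : α) :
    Nat.card (Fiber k m) = Nat.card (NoncrossingChain n 0 {x : α // ⊥ < x ∧ x ≤ m}) *
      Nat.card (NoncrossingChain n (k + 1) {x : α // ¬ (⊥ < x ∧ x ≤ m)}) := by
  rw [← Nat.card_prod]
  refine Nat.card_eq_of_bijective (fun a : Fiber k m =>
    (comap Subtype.val (fun _ _ h => h) 0 a.1 (by simp),
      comap Subtype.val (fun _ _ h => h) (k + 1) a.1 ?_)) ⟨?_, ?_⟩
  · intro j hj x hx y hxy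
    have hx' : x.1 = ⊥ := le_bot_iff.1 (hx ⟨⊥, by simp⟩)
    rcases (Nat.lt_succ_iff.1 hj).lt_or_eq with h | h
    · exact Subtype.ext (a.1.2.2.2 j h _ (fun z => hx'.trans_le bot_le) _ hxy)
    · obtain rfl : j = k := Fin.ext h
      rw [hx'] at hxy
      refine Subtype.ext (hx'.trans (Eq.symm ?_))
      by_contra hy
      exact y.2 ⟨bot_lt_iff_ne_bot.2 hy, a.2.2 _ hxy⟩
  · intro a b hab
    obtain ⟨h1, h2⟩ := Prod.ext_iff.1 hab
    have hI : ∀ j x y, (⊥ < x ∧ x ≤ m) → (⊥ < y ∧ y ≤ m) → (a.1.1 j x y ↔ b.1.1 j x y) := by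
      intro j x y hx hy
      exact Setoid.ext_iff.1 (congrFun (congrArg Subtype.val h1) j) ⟨x, hx⟩ ⟨y, hy⟩
    have hJ : ∀ j x y, ¬ (⊥ < x ∧ x ≤ m) → ¬ (⊥ < y ∧ y ≤ m) →
        (a.1.1 j x y ↔ b.1.1 j x y) := by
      intro j x y hx hy
      exact Setoid.ext_iff.1 (congrFun (congrArg Subtype.val h2) j) ⟨x, hx⟩ ⟨y, hy⟩
    have hIJ : ∀ j x y, (⊥ < x ∧ x ≤ m) → ¬ (⊥ < y ∧ y ≤ m) →
        (a.1.1 j x y ↔ b.1.1 j x y) := by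
      intro j x y hx hy
      rw [a.rel_iff j hx hy, b.rel_iff j hx hy, hI j x m hx ⟨hx.1.trans_le hx.2, le_rfl⟩,
        hJ j ⊥ y (by simp) hy]
    refine Subtype.ext (Subtype.ext (funext fun j => Setoid.ext fun x y => ?_))
    by_cases hx : ⊥ < x ∧ x ≤ m <;> by_cases hy : ⊥ < y ∧ y ≤ m
    · exact hI j x y hx hy
    · exact hIJ j x y hx hy
    · rw [Setoid.comm', hIJ j y x hy hx, Setoid.comm']
    · exact hJ j x y hx hy
  · rintro ⟨c, e⟩
    refine ⟨⟨glue c e, ?_, ?_⟩, Prod.ext (Subtype.ext (funext fun j => Setoid.ext fun x y => ?_))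
      (Subtype.ext (funext fun j => Setoid.ext fun x y => ?_))⟩
    · change glueRel _ _ _ _ _
      rcases eq_or_ne m ⊥ with rfl | hm
      · exact .inr (.inl ⟨by simp, by simp, (e.1 k).refl _⟩)
      · have hm := bot_lt_iff_ne_bot.2 hm
        exact .inr (.inr ⟨le_rfl, .inr ⟨⟨by simp, by simp, (e.1 k).refl _⟩,
          ⟨hm, le_rfl⟩, ⟨hm, le_rfl⟩, (c.1 k).refl _⟩⟩)
    · intro y h
      rcases h with ⟨_, h, _⟩ | ⟨_, h, h'⟩ | ⟨_, ⟨⟨h, _⟩, _⟩ | ⟨_, _, h, _⟩⟩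
      · exact h.2
      · exact (congrArg Subtype.val (e.2.2.2 k (by omega) ⟨⊥, by simp⟩
          (fun z => bot_le (a := z.1)) ⟨y, h⟩ h')).ge.trans bot_le
      · exact absurd h.1 (lt_irrefl _)
      · exact h.2
    · refine ⟨?_, fun h => .inl ⟨x.2, y.2, h⟩⟩
      rintro (⟨_, _, h⟩ | ⟨h, _⟩ | ⟨_, ⟨_, _, h, _⟩ | ⟨⟨h, _⟩, _⟩⟩)
      · exact h
      · exact absurd x.2 h
      · exact absurd y.2 h
      · exact absurd x.2 h
    · refine ⟨?_, fun h => .inr (.inl ⟨x.2, y.2, h⟩)⟩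
      rintro (⟨h, _⟩ | ⟨_, _, h⟩ | ⟨_, ⟨⟨h, _⟩, _⟩ | ⟨_, _, h, _⟩⟩)
      · exact absurd h x.2
      · exact h
      · exact absurd h x.2
      · exact absurd h y.2

end Glue

theorem card_fin_succ_eq_sum {k : ℕ} (hk : k < n) (d : ℕ) :
    Nat.card (NoncrossingChain n k (Fin (d + 1))) =
      ∑ p ∈ antidiagonal d, Nat.card (NoncrossingChain n 0 (Fin p.1)) *
        Nat.card (NoncrossingChain n (k + 1) (Fin (p.2 + 1))) := by
  have hex (a : NoncrossingChain n k (Fin (d + 1))) :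
      ∃ m, a.1 ⟨k, hk⟩ ⊥ m ∧ ∀ y, a.1 ⟨k, hk⟩ ⊥ y → y ≤ m := by
    obtain ⟨m, hm, h⟩ := (Set.toFinite {y | a.1 ⟨k, hk⟩ ⊥ y}).exists_maximal
      ⟨⊥, (a.1 ⟨k, hk⟩).refl ⊥⟩
    exact ⟨m, hm, fun y hy => (le_total y m).elim id (h hy)⟩
  choose f hf hf' using hex
  have hfib (m : Fin (d + 1)) (a : NoncrossingChain n k (Fin (d + 1))) :
      f a = m ↔ a.1 ⟨k, hk⟩ ⊥ m ∧ ∀ y, a.1 ⟨k, hk⟩ ⊥ y → y ≤ m :=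
    ⟨fun h => h ▸ ⟨hf a, hf' a⟩, fun h => le_antisymm (h.2 _ (hf a)) (hf' a _ h.1)⟩
  rw [← Nat.card_congr (Equiv.sigmaFiberEquiv f), Nat.card_sigma,
    Finset.Nat.sum_antidiagonal_eq_sum_range_succ_mk, ← Fin.sum_univ_eq_sum_range (fun i =>
      Nat.card (NoncrossingChain n 0 (Fin i)) *
        Nat.card (NoncrossingChain n (k + 1) (Fin (d - i + 1))))]
  refine Finset.sum_congr rfl fun m _ => ?_
  have hI : Fintype.card {x : Fin (d + 1) // ⊥ < x ∧ x ≤ m} = m := by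
    rw [Fintype.card_subtype, show univ.filter (fun x => ⊥ < x ∧ x ≤ m) = Ioc ⊥ m by
      ext x; simp, Fin.card_Ioc]
    exact Nat.sub_zero _
  have hJ : Fintype.card {x : Fin (d + 1) // ¬ (⊥ < x ∧ x ≤ m)} = d - m + 1 := by
    rw [Fintype.card_subtype_compl, hI, Fintype.card_fin]
    omega
  rw [card_congr (Fintype.orderIsoFinOfCardEq _ hI),
    card_congr (Fintype.orderIsoFinOfCardEq _ hJ)]
  exact (Nat.card_congr (Equiv.subtypeEquivRight (hfib m))).trans (card_fiber ⟨k, hk⟩ m)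

theorem card_fin_succ_self (d : ℕ) :
    Nat.card (NoncrossingChain n n (Fin (d + 1))) =
      Nat.card (NoncrossingChain n 0 (Fin d)) := by
  refine Nat.card_eq_of_bijective
    (fun a => comap Fin.succ (Fin.strictMono_succ) 0 a (by simp)) ⟨?_, ?_⟩
  · intro a b hab
    refine Subtype.ext (funext fun j => Setoid.ext fun x y => ?_)
    have h0 (a : NoncrossingChain n n (Fin (d + 1))) (y) : a.1 j 0 y ↔ 0 = y :=
      ⟨a.2.2.2 j j.2 0 (fun z => Fin.zero_le z) y, fun h => h ▸ (a.1 j).refl _⟩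
    cases x using Fin.cases with
    | zero => rw [h0, h0]
    | succ x =>
      cases y using Fin.cases with
      | zero => rw [Setoid.comm', h0, Setoid.comm', h0]
      | succ y => exact Setoid.ext_iff.1 (congrFun (congrArg Subtype.val hab) j) x y
  · intro c
    let s (j : Fin n) : Setoid (Fin (d + 1)) :=
      Setoid.ker (Fin.cases none fun x => some (Quotient.mk (c.1 j) x))
    have hs (j x y) : s j (Fin.succ x) (Fin.succ y) ↔ c.1 j x y := by
      simp [s, Setoid.ker_def, Quotient.eq]
    have hs0 (j x) : ¬ s j 0 (Fin.succ x) := by simp [s, Setoid.ker_def]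
    have hs0' (j x) : ¬ s j (Fin.succ x) 0 := by simp [s, Setoid.ker_def]
    refine ⟨⟨s, ?_, ?_, ?_⟩, Subtype.ext (funext fun j => Setoid.ext fun x y => hs j x y)⟩
    · intro j x y z w hxy hyz hzw h h'
      cases z using Fin.cases with
      | zero => simp at hyz
      | succ z =>
      cases y using Fin.cases with
      | zero => simp at hxy
      | succ y =>
      cases w using Fin.cases with
      | zero => simp at hzw
      | succ w =>
      cases x using Fin.cases with
      | zero => exact absurd h (hs0 _ _)
      | succ x =>
        rw [hs] at *
        exact c.2.1 j x y z w (by simpa using hxy) (by simpa using hyz) (by simpa using hzw) h h'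
    · intro i j hij x y h
      cases x using Fin.cases <;> cases y using Fin.cases
      · exact (s j).refl _
      · exact absurd h (hs0 _ _)
      · exact absurd h (hs0' _ _)
      · rw [hs] at *
        exact c.2.2.1 i j hij _ _ h
    · intro j _ x hx y h
      obtain rfl : x = 0 := le_antisymm (hx 0) (Fin.zero_le x)
      cases y using Fin.cases
      · rfl
      · exact absurd h (hs0 _ _)

end NoncrossingChain

open PowerSeries in
theorem PowerSeries.coeff_pow_of_eq_one_add_X_mul_pow {n : ℕ} {F : PowerSeries ℚ}
    (hF : F = 1 + X * F ^ (n + 1)) (d k : ℕ) :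
    coeff (d + 1) (F ^ k) * (d + 1) = k * (n * (d + 1) + d + k).choose d := by
  have hF0 : constantCoeff F = 1 := by rw [hF]; simp
  induction d generalizing k with
  | zero =>
    induction k with
    | zero => simp [coeff_one]
    | succ k ih =>
      have h : F ^ (k + 1) = F ^ k + X * F ^ (k + (n + 1)) := by
        rw [pow_succ]; nth_rewrite 2 [hF]; ring
      rw [h, map_add, coeff_succ_X_mul]
      simp [hF0] at ih ⊢
      simp [ih]
  | succ d ihd =>
    induction k with
    | zero => simp [coeff_one]
    | succ k ih =>
      have h : F ^ (k + 1) = F ^ k + X * F ^ (k + (n + 1)) := by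
        rw [pow_succ]; nth_rewrite 2 [hF]; ring
      rw [h, map_add, coeff_succ_X_mul]
      have h1 := ihd (k + (n + 1))
      rw [show n * (d + 1) + d + (k + (n + 1)) = n * (d + 1 + 1) + (d + 1) + k by ring] at h1
      have h2 : ((n * (d + 1 + 1) + (d + 1) + k).choose (d + 1) : ℚ) * (d + 1) =
          (n * (d + 1 + 1) + (d + 1) + k).choose d * (n * (d + 2) + k + 1) := by
        have := Nat.choose_succ_right_eq (n * (d + 1 + 1) + (d + 1) + k) d
        rw [show n * (d + 1 + 1) + (d + 1) + k - d = n * (d + 2) + k + 1 by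
          rw [Nat.sub_eq_iff_eq_add (by omega)]; ring] at this
        exact_mod_cast this
      rw [← add_assoc (n * (d + 1 + 1) + (d + 1)) k 1, Nat.choose_succ_succ]
      have hd : (d + 1 : ℚ) ≠ 0 := by positivity
      apply mul_right_cancel₀ hd
      push_cast at *
      linear_combination (d + 1 : ℚ) * ih + (d + 2 : ℚ) * h1 - h2

open PowerSeries in
theorem NoncrossingChain.card_fin_succ_mul (n d : ℕ) :
    Nat.card (NoncrossingChain n 0 (Fin (d + 1))) * (d + 1) =
      ((d + 1) * (n + 1)).choose d := by
  let F : PowerSeries ℚ := mk fun d => (Nat.card (NoncrossingChain n 0 (Fin d)) : ℚ)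
  let t (k : ℕ) : PowerSeries ℚ :=
    mk fun d => (Nat.card (NoncrossingChain n k (Fin (d + 1))) : ℚ)
  have htn : t n = F := by
    ext d
    simp only [t, F, coeff_mk, card_fin_succ_self]
  have ht (i : ℕ) (hi : i ≤ n) : t (n - i) = F ^ (i + 1) := by
    induction i with
    | zero => simpa using htn
    | succ i ih =>
      rw [pow_succ', ← ih (by omega), show n - i = n - (i + 1) + 1 by omega]
      ext d
      simp only [t, F, coeff_mul, coeff_mk]
      rw [card_fin_succ_eq_sum (show n - (i + 1) < n by omega) d]
      push_cast
      rfl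
  have hF : F = 1 + X * F ^ (n + 1) := by
    rw [← ht n le_rfl, Nat.sub_self]
    ext d
    cases d with
    | zero =>
      have : Subsingleton (Setoid (Fin 0)) := ⟨fun _ _ => Setoid.ext fun x => x.elim0⟩
      have : Unique (NoncrossingChain n 0 (Fin 0)) :=
        { default := ⟨fun _ => ⊤, fun _ x => x.elim0, fun _ _ _ x => x.elim0,
            fun _ _ x => x.elim0⟩
          uniq := fun _ => Subtype.ext (Subsingleton.elim _ _) }
      simp [F]
    | succ d => simp [F, t, coeff_one, coeff_succ_X_mul]
  have h := coeff_pow_of_eq_one_add_X_mul_pow hF d 1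
  rw [show n * (d + 1) + d + 1 = (d + 1) * (n + 1) by ring] at h
  simp only [pow_one, F, coeff_mk, Nat.cast_one, one_mul] at h
  exact_mod_cast h

/-- Edelman's theorem: the number of multi-chains
`1 ≤ a₁ ≤ ⋯ ≤ a_{r-1} ≤ ⊤` in the lattice of noncrossing partitions of `{1,…,d}`
(ordered by refinement) is `(d*r).choose (d-1) / d`. -/
theorem zeta_polynomial_noncrossing (d r : ℕ) (hd : 1 ≤ d) (hr : 1 ≤ r) :
    Nat.card {a : Fin (r-1) → Setoid (Fin d) //
        (∀ k, IsNoncrossing (a k)) ∧ (∀ j k : Fin (r-1), j ≤ k → a j ≤ a k)}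
      = (d * r).choose (d - 1) / d := by
  obtain ⟨d, rfl⟩ := Nat.exists_eq_add_of_le' hd
  obtain ⟨n, rfl⟩ := Nat.exists_eq_add_of_le' hr
  rw [Nat.add_sub_cancel, Nat.add_sub_cancel, ← NoncrossingChain.card_fin_succ_mul,
    Nat.mul_div_cancel _ d.succ_pos]
  refine Nat.card_congr (Equiv.subtypeEquivRight fun a => ?_)
  refine and_congr (forall_congr' fun j => ?_) ?_
  · constructor
    · intro h x y z w hxy hyz hzw hxz hyw
      by_contra hn
      exact h ⟨x, y, z, w, hxy, hyz, hzw, hxz, hyw, hn⟩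
    · rintro h ⟨x, y, z, w, hxy, hyz, hzw, hxz, hyw, hn⟩
      exact hn (h x y z w hxy hyz hzw hxz hyw)
  · exact ⟨fun h => ⟨fun i j hij x y => @h i j hij x y, by simp⟩,
      fun h i j hij x y => h.1 i j hij x y⟩
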